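/- arXiv:2507.09399 — 5 statements merged into one kernel-verified Lean document; each statement's English description precedes it below -/
import Mathlib

section
/- Let E = (e(i,j)) be an n×n real matrix with strictly positive entries satisfying the basic assumptions. Let t ∈ ℝ^n_+ and let 1 ≤ j, k ≤ n. If t_k is dominant in n̂_j(t), then t_k is dominant in n̂_k(t); and if t_k is strictly dominant in n̂_j(t) with j ≠ k, then t_k is strictly dominant in n̂_k(t). -/
/-- An n×n real matrix with strictly positive entries satisfies the *basic assumptions*
if its diagonal entries are 1 and `e j l ≤ e j k * e k l` for all `j k l`. -/
def BasicAssumptions {n : ℕ} (e : Fin n → Fin n → ℝ) : Prop :=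
  (∀ i j, 0 < e i j) ∧ (∀ j, e j j = 1) ∧ (∀ j k l, e j l ≤ e j k * e k l)

/-- if `t k` is (strictly) dominant in `n̂ j (t)`, it is (strictly)
dominant in `n̂ k (t)`, where `n̂ i (t) = max_j t j / e j i`. -/
theorem stmt0 {n : ℕ} (e : Fin n → Fin n → ℝ) (hE : BasicAssumptions e)
    (t : Fin n → ℝ) (ht : ∀ i, 0 ≤ t i) (j k : Fin n) :
    ((∀ i, t i / e i j ≤ t k / e k j) → (∀ i, t i / e i k ≤ t k / e k k)) ∧
    (j ≠ k → (∀ i, i ≠ k → t i / e i j < t k / e k j) →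
      (∀ i, i ≠ k → t i / e i k < t k / e k k)) := by
  obtain ⟨hpos, hdiag, hmul⟩ := hE
  have key : ∀ i, t k * e i j ≤ (t k * e i k) * e k j := fun i => by
    have := mul_le_mul_of_nonneg_left (hmul i k j) (ht k)
    linarith
  refine ⟨fun h i => ?_, fun _ h i hi => ?_⟩
  · have h1 := (div_le_div_iff₀ (hpos i j) (hpos k j)).1 (h i)
    rw [hdiag k, div_one, div_le_iff₀ (hpos i k)]
    exact le_of_mul_le_mul_right (h1.trans (key i)) (hpos k j)
  · have h1 := (div_lt_div_iff₀ (hpos i j) (hpos k j)).1 (h i hi)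
    rw [hdiag k, div_one, div_lt_iff₀ (hpos i k)]
    exact lt_of_mul_lt_mul_right (h1.trans_le (key i)) (hpos k j).le
end

section
/- If E is a standard n×n matrix, then the principal cone Γ(E) = {t ∈ ℝ^n_+ : t_i ≤ e(i,j)·t_j for all 1 ≤ i,j ≤ n} has nonempty interior in ℝ^n. -/
/-- A matrix is *standard* if it satisfies the basic assumptions and
`1 < e j k * e k j` for `j ≠ k`. -/
def IsStandard {n : ℕ} (e : Fin n → Fin n → ℝ) : Prop :=
  BasicAssumptions e ∧ ∀ j k, j ≠ k → 1 < e j k * e k j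

/-- The principal cone `Γ(E)`. -/
def GammaE {n : ℕ} (e : Fin n → Fin n → ℝ) : Set (Fin n → ℝ) :=
  {t | (∀ j, 0 ≤ t j) ∧ ∀ i j, t i ≤ e i j * t j}

/-- for a standard matrix the principal cone has nonempty interior. -/
theorem stmt1 {n : ℕ} (e : Fin n → Fin n → ℝ) (hE : IsStandard e) :
    (interior (GammaE e)).Nonempty := by
  obtain ⟨⟨hpos, hdiag, hmul⟩, hst⟩ := hE
  refine ⟨fun i => ∑ k, e i k, ?_⟩
  rw [mem_interior]
  refine ⟨{t | (∀ j, 0 < t j) ∧ ∀ i j, i ≠ j → t i < e i j * t j}, ?_, ?_, ?_⟩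
  · rintro t ⟨h0, h1⟩
    refine ⟨fun j => (h0 j).le, fun i j => ?_⟩
    by_cases hij : i = j
    · subst hij
      rw [hdiag, one_mul]
    · exact (h1 i j hij).le
  · simp only [Set.setOf_and, Set.setOf_forall]
    refine IsOpen.inter ?_ ?_
    · exact isOpen_iInter_of_finite fun j => isOpen_lt (by fun_prop) (by fun_prop)
    · refine isOpen_iInter_of_finite fun i => isOpen_iInter_of_finite fun j =>
        isOpen_iInter_of_finite fun _ => isOpen_lt (by fun_prop) (by fun_prop)
  · refine ⟨fun j => Finset.sum_pos (fun k _ => hpos j k) ⟨j, Finset.mem_univ j⟩, ?_⟩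
    intro i j hij
    change ∑ k, e i k < e i j * ∑ k, e j k
    rw [Finset.mul_sum]
    refine Finset.sum_lt_sum (fun k _ => hmul i j k) ⟨i, Finset.mem_univ i, ?_⟩
    rw [hdiag]
    exact hst i j hij
end

section
/- Let E be a standard n×n matrix and let S = {(A_1,k_1),…,(A_s,k_s)} ∈ 𝒮_E. Then Γ_S = {t ∈ ℝ^n_+ : t_j ≤ t_{k_r}/e(k_r,j) for all 1 ≤ r ≤ s and all j ∈ A_r, and t_{k_p} ≤ τ_S(k_p,k_q)·t_{k_q} for all 1 ≤ p,q ≤ s}. -/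
/-- A marked partition of `{1,…,n}`: a partition into (nonempty) sets `A r`
together with a marked element `k r ∈ A r` for each `r`. -/
structure MarkedPartition (n : ℕ) where
  s : ℕ
  A : Fin s → Finset (Fin n)
  k : Fin s → Fin n
  mem_k : ∀ r, k r ∈ A r
  disj : ∀ r r', r ≠ r' → Disjoint (A r) (A r')
  cover : ∀ i : Fin n, ∃ r, i ∈ A r

/-- The cone `Γ_S` associated to a marked partition `S`. -/
def GammaS {n : ℕ} (e : Fin n → Fin n → ℝ) (S : MarkedPartition n) : Set (Fin n → ℝ) :=
  {t | (∀ j, 0 ≤ t j) ∧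
    ∀ r : Fin S.s, ∀ i ∈ S.A r, ∀ j, t j / e j i ≤ t (S.k r) / e (S.k r) i}

/-- `𝒮_E`: the marked partitions whose cone has nonempty interior. -/
def SE {n : ℕ} (e : Fin n → Fin n → ℝ) : Set (MarkedPartition n) :=
  {S | (interior (GammaS e S)).Nonempty}

/-- `τ_S(k_p, k_q) = min_{ℓ ∈ A_q} e(k_p,ℓ)/e(k_q,ℓ)`. -/
noncomputable def tauS {n : ℕ} (e : Fin n → Fin n → ℝ) (S : MarkedPartition n)
    (p q : Fin S.s) : ℝ :=
  (S.A q).inf' ⟨S.k q, S.mem_k q⟩ (fun l => e (S.k p) l / e (S.k q) l)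

/-- explicit description of `Γ_S` for `S ∈ 𝒮_E`. -/
theorem stmt2 {n : ℕ} (e : Fin n → Fin n → ℝ) (hE : IsStandard e)
    (S : MarkedPartition n) (hS : S ∈ SE e) :
    GammaS e S =
      {t | (∀ j, 0 ≤ t j) ∧
        (∀ r : Fin S.s, ∀ j ∈ S.A r, t j ≤ t (S.k r) / e (S.k r) j) ∧
        ∀ p q : Fin S.s, t (S.k p) ≤ tauS e S p q * t (S.k q)} := by
  obtain ⟨⟨hpos, hdiag, htri⟩, -⟩ := hE
  ext t
  simp only [GammaS, Set.mem_setOf_eq]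
  constructor
  · rintro ⟨h0, h⟩
    refine ⟨h0, ?_, ?_⟩
    · intro r j hj
      have := h r j hj j
      rwa [hdiag, div_one] at this
    · intro p q
      obtain ⟨l, hl, hle⟩ := Finset.exists_mem_eq_inf' ⟨S.k q, S.mem_k q⟩
        (fun l => e (S.k p) l / e (S.k q) l)
      unfold tauS
      rw [hle]
      have h1 := h q l hl (S.k p)
      rw [div_le_iff₀ (hpos _ _)] at h1
      calc t (S.k p) ≤ t (S.k q) / e (S.k q) l * e (S.k p) l := h1
        _ = _ := by ring
  · rintro ⟨h0, h1, h2⟩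
    refine ⟨h0, ?_⟩
    intro r i hi j
    obtain ⟨p, hp⟩ := S.cover j
    have hτ : tauS e S p r ≤ e (S.k p) i / e (S.k r) i :=
      Finset.inf'_le (fun l => e (S.k p) l / e (S.k r) l) hi
    have a1 : t j / e j i ≤ t (S.k p) / e (S.k p) i := by
      have b1 := h1 p j hp
      rw [le_div_iff₀ (hpos _ _)] at b1
      rw [div_le_div_iff₀ (hpos _ _) (hpos _ _)]
      calc t j * e (S.k p) i ≤ t j * (e (S.k p) j * e j i) :=
            mul_le_mul_of_nonneg_left (htri _ _ _) (h0 j)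
        _ = t j * e (S.k p) j * e j i := by ring
        _ ≤ t (S.k p) * e j i := mul_le_mul_of_nonneg_right b1 (hpos _ _).le
    refine a1.trans ?_
    rw [div_le_iff₀ (hpos _ _)]
    calc t (S.k p) ≤ tauS e S p r * t (S.k r) := h2 p r
      _ ≤ e (S.k p) i / e (S.k r) i * t (S.k r) := mul_le_mul_of_nonneg_right hτ (h0 _)
      _ = _ := by ring
end

section
/- Let E be a standard n×n matrix and 0 ≠ t ∈ ℝ^n_+, and set 𝒮(t) = {S ∈ 𝒮_E : t ∈ Γ_S}. Then there exists S_0 = {(A_1,k_1),…,(A_{s_0},k_{s_0})} ∈ 𝒮(t) such that: (a) t_{k_p} < e(k_p,k_q)·t_{k_q} for all 1 ≤ p ≠ q ≤ s_0; and (b) for every T ∈ 𝒮(t), the set of marked elements {k_1,…,k_{s_0}} of S_0 is contained in the set of marked elements of T. -/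
/-- `D(S)`: the set of marked elements of `S`. -/
def DS {n : ℕ} (S : MarkedPartition n) : Finset (Fin n) :=
  Finset.image S.k Finset.univ

open Filter Topology in
theorem aux_max {n : ℕ} (e : Fin n → Fin n → ℝ) (hE : IsStandard e)
    (t : Fin n → ℝ) (ht : ∀ j, 0 ≤ t j) (ht0 : t ≠ 0) (i : Fin n) :
    ∃ k, (∀ j, j ≠ k → t j < e j k * t k) ∧ ∀ j, t j / e j i ≤ t k / e k i := by
  classical
  obtain ⟨⟨hpos, hdiag, htri⟩, hstd⟩ := hE
  obtain ⟨m, hm⟩ : ∃ m, 0 < t m := by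
    by_contra! h
    exact ht0 (funext fun j => le_antisymm (h j) (ht j))
  let N : Fin n → Finset (Fin n) := fun k => Finset.univ.filter (fun l => e k l * t l ≤ t k)
  let M : Finset (Fin n) := Finset.univ.filter (fun k => ∀ j, t j / e j i ≤ t k / e k i)
  have hM : M.Nonempty := by
    obtain ⟨k, -, hk⟩ := Finset.exists_max_image Finset.univ (fun j => t j / e j i) ⟨i, Finset.mem_univ i⟩
    exact ⟨k, by simpa [M] using hk⟩
  obtain ⟨k, hkM, hk⟩ := Finset.exists_max_image M (fun k => (N k).card) hM
  have hkM' : ∀ j, t j / e j i ≤ t k / e k i := by simpa [M] using hkM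
  have htk : 0 < t k := by
    have h1 : 0 < t k / e k i := lt_of_lt_of_le (div_pos hm (hpos m i)) (hkM' m)
    have := mul_pos h1 (hpos k i)
    rwa [div_mul_cancel₀ _ (hpos k i).ne'] at this
  refine ⟨k, ?_, hkM'⟩
  intro j hjk
  by_contra! hj
  have hge : t k / e k i ≤ t j / e j i := by
    rw [div_le_div_iff₀ (hpos k i) (hpos j i)]
    calc t k * e j i ≤ t k * (e j k * e k i) := by gcongr; exact htri j k i
      _ = (e j k * t k) * e k i := by ring
      _ ≤ t j * e k i := by have := hpos k i; gcongr
  have hjM : j ∈ M := by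
    simp only [M, Finset.mem_filter, Finset.mem_univ, true_and]
    exact fun l => (hkM' l).trans hge
  have hlt : (N k).card < (N j).card := by
    apply Finset.card_lt_card
    rw [Finset.ssubset_iff_of_subset]
    · refine ⟨j, by simp [N, hdiag], ?_⟩
      simp only [N, Finset.mem_filter, Finset.mem_univ, true_and, not_le]
      have h1 := hstd k j hjk.symm
      have h2 : e k j * (e j k * t k) ≤ e k j * t j := by have := hpos k j; gcongr
      nlinarith
    · intro l hl
      simp only [N, Finset.mem_filter, Finset.mem_univ, true_and] at hl ⊢
      calc e j l * t l ≤ (e j k * e k l) * t l := by have := ht l; gcongr; exact htri j k l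
        _ = e j k * (e k l * t l) := by ring
        _ ≤ e j k * t k := by have := hpos j k; gcongr
        _ ≤ t j := hj
  exact absurd (hk j hjM) (not_le.mpr hlt)

open Filter Topology in
theorem stmt3 {n : ℕ} (e : Fin n → Fin n → ℝ) (hE : IsStandard e)
    (t : Fin n → ℝ) (ht : ∀ j, 0 ≤ t j) (ht0 : t ≠ 0) :
    ∃ S0 : MarkedPartition n, S0 ∈ SE e ∧ t ∈ GammaS e S0 ∧
      (∀ p q : Fin S0.s, p ≠ q → t (S0.k p) < e (S0.k p) (S0.k q) * t (S0.k q)) ∧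
      (∀ T : MarkedPartition n, T ∈ SE e → t ∈ GammaS e T → DS S0 ⊆ DS T) := by
  classical
  have hmax := aux_max e hE t ht ht0
  obtain ⟨⟨hpos, hdiag, htri⟩, hstd⟩ := hE
  obtain ⟨m, hm⟩ : ∃ m, 0 < t m := by
    by_contra! h
    exact ht0 (funext fun j => le_antisymm (h j) (ht j))
  let D : Finset (Fin n) := Finset.univ.filter (fun k => ∀ j, j ≠ k → t j < e j k * t k)
  have hD : ∀ k, k ∈ D ↔ ∀ j, j ≠ k → t j < e j k * t k := by simp [D]
  let c : Fin n → ℕ := fun j => if j ∈ D then j else n + j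
  have hcinj : ∀ a b, c a = c b → a = b := by
    intro a b h
    have := a.2; have := b.2
    simp only [c] at h
    apply Fin.ext
    split_ifs at h <;> omega
  have hex : ∀ i, ∃ k, k ∈ D ∧ (∀ j, t j / e j i ≤ t k / e k i) ∧
      ∀ j, j ≠ k → t j / e j i = t k / e k i → c k < c j := by
    intro i
    let M : Finset (Fin n) := Finset.univ.filter (fun k => ∀ j, t j / e j i ≤ t k / e k i)
    obtain ⟨k0, hk0, hk0'⟩ := hmax i
    have hk0M : k0 ∈ M := by simpa [M] using hk0'
    have hk0D : k0 ∈ D := (hD k0).2 hk0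
    obtain ⟨k, hkM, hk⟩ := Finset.exists_min_image M c ⟨k0, hk0M⟩
    have hkM' : ∀ j, t j / e j i ≤ t k / e k i := by simpa [M] using hkM
    refine ⟨k, ?_, hkM', ?_⟩
    · by_contra hkD
      have h := hk k0 hk0M
      simp only [c, hk0D, hkD, if_true, if_false] at h
      have := k0.2
      omega
    · intro j hjk hj
      have hjM : j ∈ M := by
        simp only [M, Finset.mem_filter, Finset.mem_univ, true_and]
        intro l; rw [hj]; exact hkM' l
      exact lt_of_le_of_ne (hk j hjM) (fun h => hjk (hcinj _ _ h).symm)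
  choose κ hκD hκmax hκtie using hex
  have hfix : ∀ k T, k ∈ D → (∀ j, t j / e j k ≤ t T / e T k) → T = k := by
    intro k T hk h
    by_contra hne
    have h1 := (hD k).1 hk T hne
    have h2 := h k
    rw [hdiag, div_one, le_div_iff₀ (hpos T k)] at h2
    linarith
  have hκpos : ∀ i, 0 < t (κ i) / e (κ i) i := fun i =>
    lt_of_lt_of_le (div_pos hm (hpos m i)) (hκmax i m)
  let f := D.equivFin
  let S0 : MarkedPartition n :=
    { s := D.card
      A := fun r => Finset.univ.filter (fun i => κ i = (f.symm r : Fin n))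
      k := fun r => (f.symm r : Fin n)
      mem_k := by
        intro r
        simp only [Finset.mem_filter, Finset.mem_univ, true_and]
        exact hfix _ _ (f.symm r).2 (hκmax _)
      disj := by
        intro r r' hr
        rw [Finset.disjoint_left]
        intro i hi hi'
        simp only [Finset.mem_filter, Finset.mem_univ, true_and] at hi hi'
        exact hr (f.symm.injective (Subtype.ext (hi.symm.trans hi')))
      cover := by
        intro i
        exact ⟨f ⟨κ i, hκD i⟩, by simp⟩ }
  have hA : ∀ r i, i ∈ S0.A r → κ i = S0.k r := by
    intro r i hi
    simpa [S0] using hi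
  refine ⟨S0, ?_, ?_, ?_, ?_⟩
  · -- interior
    let s : ℝ → Fin n → ℝ := fun ε j => t j * (1 - ε * c j) + (if t j = 0 then ε else 0)
    have hs0 : ∀ j, Tendsto (fun ε => s ε j) (𝓝[>] 0) (𝓝 (t j)) := by
      intro j
      have hc : Continuous (fun ε => s ε j) := by
        by_cases h : t j = 0 <;> simp only [s, h, if_true, if_false] <;> fun_prop
      have h := hc.tendsto 0
      have h0 : s 0 j = t j := by simp [s]
      rw [h0] at h
      exact h.mono_left nhdsWithin_le_nhds
    have hεpos : ∀ᶠ ε : ℝ in 𝓝[>] 0, 0 < ε := eventually_mem_nhdsWithin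
    have h1 : ∀ᶠ ε in 𝓝[>] (0:ℝ), ∀ j, 0 < s ε j := by
      rw [eventually_all]
      intro j
      by_cases h : t j = 0
      · filter_upwards [hεpos] with ε hε
        simpa [s, h] using hε
      · exact (hs0 j).eventually_const_lt (lt_of_le_of_ne (ht j) (Ne.symm h))
    have h2 : ∀ᶠ ε in 𝓝[>] (0:ℝ), ∀ i j, j ≠ κ i → s ε j / e j i < s ε (κ i) / e (κ i) i := by
      rw [eventually_all]
      intro i
      rw [eventually_all]
      intro j
      by_cases hj : j = κ i
      · exact Eventually.of_forall fun _ h => absurd hj h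
      rcases (hκmax i j).lt_or_eq with hlt | heq
      · filter_upwards [((hs0 j).div_const (e j i)).eventually_lt
          ((hs0 (κ i)).div_const (e (κ i) i)) hlt] with ε hε _
        exact hε
      · have hc := hκtie i j hj heq
        have hk := hκpos i
        have htk : t (κ i) ≠ 0 := fun h => by simp [h] at hk
        have htj : t j ≠ 0 := fun h => by simp [h] at heq; exact hk.ne heq
        filter_upwards [hεpos] with ε hε _
        simp only [s, htk, htj, if_false, add_zero]
        rw [mul_div_right_comm, mul_div_right_comm, heq]
        have hc' : (c (κ i) : ℝ) < c j := by exact_mod_cast hc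
        have := mul_lt_mul_of_pos_left hc' hε
        exact mul_lt_mul_of_pos_left (by linarith) hk
    obtain ⟨ε, hε1, hε2⟩ := (h1.and h2).exists
    let U : Set (Fin n → ℝ) := {x | (∀ j, 0 < x j) ∧
      ∀ i j, j ≠ κ i → x j / e j i < x (κ i) / e (κ i) i}
    have hU : IsOpen U := by
      apply IsOpen.and
      · simp only [Set.setOf_forall]
        exact isOpen_iInter_of_finite fun j => isOpen_lt (by fun_prop) (by fun_prop)
      · simp only [Set.setOf_forall]
        exact isOpen_iInter_of_finite fun i => isOpen_iInter_of_finite fun j =>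
          isOpen_iInter_of_finite fun _ => isOpen_lt (by fun_prop) (by fun_prop)
    have hsub : U ⊆ GammaS e S0 := by
      rintro x ⟨hx1, hx2⟩
      refine ⟨fun j => (hx1 j).le, ?_⟩
      intro r i hi j
      rw [← hA r i hi]
      by_cases hj : j = κ i
      · rw [hj]
      · exact (hx2 i j hj).le
    exact ⟨s ε, interior_maximal hsub hU ⟨hε1, hε2⟩⟩
  · refine ⟨ht, ?_⟩
    intro r i hi j
    rw [← hA r i hi]
    exact hκmax i j
  · intro p q hpq
    apply (hD _).1 (f.symm q).2
    intro h
    exact hpq (f.symm.injective (Subtype.ext h))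
  · intro T _ hT k hk
    simp only [DS, Finset.mem_image, Finset.mem_univ, true_and] at hk ⊢
    obtain ⟨r, rfl⟩ := hk
    obtain ⟨r', hr'⟩ := T.cover (S0.k r)
    exact ⟨r', hfix _ _ (f.symm r).2 (hT.2 r' _ hr')⟩
end

section
/- Let E be a standard n×n matrix. There is a constant κ > 0 depending only on E such that, with |t − u| = max_{1≤i≤n}|t_i − u_i|: (i) every L ∈ 𝓛 is at distance less than κ from Γ(E); more precisely, if L ∈ 𝓛 and L ∈ Γ_S for a marked partition S, then L is at distance less than κ from F_S = Γ_S ∩ Γ(E); (ii) every point t ∈ Γ(E) is at distance less than κ from the set 𝓛; (iii) for all L, L' ∈ 𝓛, the componentwise minimum L ∧ L' ∈ ℕ^n is at distance less than κ from 𝓛; (iv) if L, L' ∈ 𝓛 and T_L ∩ T_{L'} ≠ ∅, then |L − L'| ≤ κ. -/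
/-- `Γ(D)`. -/
def GammaD {n : ℕ} (e : Fin n → Fin n → ℝ) (D : Finset (Fin n)) : Set (Fin n → ℝ) :=
  if D = ∅ then {0}
  else {t | t ≠ 0 ∧ (∀ j, 0 ≤ t j) ∧
    (∃ S : MarkedPartition n, S ∈ SE e ∧ t ∈ GammaS e S ∧ DS S = D) ∧
    (∀ T : MarkedPartition n, T ∈ SE e → t ∈ GammaS e T → D ⊆ DS T)}

/-- Maximality of `Q_L` in `𝒬_D`. -/
def QmaxIn {n : ℕ} (e : Fin n → Fin n → ℝ) (D : Finset (Fin n)) (L : Fin n → ℕ) : Prop :=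
  (fun j => (L j : ℝ)) ∈ GammaD e D ∧
  ∀ j ∉ D, (fun i => ((Function.update L j (L j + 1)) i : ℝ)) ∉ GammaD e D

/-- `𝓛(D)`. -/
def LLD {n : ℕ} (e : Fin n → Fin n → ℝ) (D : Finset (Fin n)) : Set (Fin n → ℕ) :=
  {L | QmaxIn e D L}

/-- `𝓛`. -/
def LLall {n : ℕ} (e : Fin n → Fin n → ℝ) : Set (Fin n → ℕ) :=
  ⋃ D : Finset (Fin n), LLD e D

/-- The tube `T_L` relative to `D`. -/
def Tube {n : ℕ} (D : Finset (Fin n)) (L : Fin n → ℕ) : Set (Fin n → ℝ) :=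
  {t | ∀ j, 0 ≤ t j ∧ t j ≤ (L j : ℝ) + 1/2 ∧ (j ∈ D → (L j : ℝ) - 1/2 ≤ t j)}

/-- The maximum of `t j / e j i` over `j`. -/
noncomputable def Nm {n : ℕ} (e : Fin n → Fin n → ℝ) (t : Fin n → ℝ) (i : Fin n) : ℝ :=
  ⨆ j, t j / e j i

/-- `j` realises the maximum at `i`. -/
def Mx {n : ℕ} (e : Fin n → Fin n → ℝ) (t : Fin n → ℝ) (i j : Fin n) : Prop :=
  ∀ k, t k / e k i ≤ t j / e j i

open Classical in
/-- The strictly dominant indices. -/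
noncomputable def Dl {n : ℕ} (e : Fin n → Fin n → ℝ) (t : Fin n → ℝ) : Finset (Fin n) :=
  Finset.univ.filter (fun j => 0 < t j ∧ ∀ k, k ≠ j → t k < e k j * t j)

theorem mem_Dl {n : ℕ} {e : Fin n → Fin n → ℝ} {t : Fin n → ℝ} {j : Fin n} :
    j ∈ Dl e t ↔ 0 < t j ∧ ∀ k, k ≠ j → t k < e k j * t j := by
  simp [Dl]

theorem le_Nm {n : ℕ} (e : Fin n → Fin n → ℝ) (t : Fin n → ℝ) (i j : Fin n) :
    t j / e j i ≤ Nm e t i :=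
  le_ciSup (f := fun j => t j / e j i) (Set.finite_range _).bddAbove j

theorem Nm_attained {n : ℕ} (e : Fin n → Fin n → ℝ) (t : Fin n → ℝ) (i : Fin n) :
    ∃ j, t j / e j i = Nm e t i := by
  have : Nonempty (Fin n) := ⟨i⟩
  exact exists_eq_ciSup_of_finite (f := fun j => t j / e j i)

theorem Nm_le {n : ℕ} {e : Fin n → Fin n → ℝ} {t : Fin n → ℝ} {i : Fin n} {c : ℝ}
    (h : ∀ j, t j / e j i ≤ c) : Nm e t i ≤ c := by
  have : Nonempty (Fin n) := ⟨i⟩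
  exact ciSup_le h

theorem Mx.Nm_eq {n : ℕ} {e : Fin n → Fin n → ℝ} {t : Fin n → ℝ} {i j : Fin n}
    (h : Mx e t i j) : Nm e t i = t j / e j i :=
  le_antisymm (Nm_le h) (le_Nm e t i j)

theorem self_le_Nm {n : ℕ} {e : Fin n → Fin n → ℝ} (hE : IsStandard e) (t : Fin n → ℝ)
    (i : Fin n) : t i ≤ Nm e t i := by
  have := le_Nm e t i i
  rwa [hE.1.2.1, div_one] at this

theorem exists_Mx {n : ℕ} (e : Fin n → Fin n → ℝ) (t : Fin n → ℝ) (i : Fin n) :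
    ∃ j, Mx e t i j := by
  obtain ⟨j, hj⟩ := Nm_attained e t i
  exact ⟨j, fun k => hj ▸ le_Nm e t i k⟩

/-- Transitivity of the relation `Mx`. -/
theorem Mx.trans {n : ℕ} {e : Fin n → Fin n → ℝ} (hE : IsStandard e) {t : Fin n → ℝ}
    (ht : ∀ j, 0 ≤ t j) {i j k : Fin n}
    (h : Mx e t i j) (h' : Mx e t j k) : Mx e t i k := by
  obtain ⟨⟨hp, h1, hm⟩, -⟩ := hE
  intro l
  refine (h l).trans ?_
  have a := h' j
  rw [h1, div_one, le_div_iff₀ (hp _ _)] at a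
  rw [div_le_div_iff₀ (hp _ _) (hp _ _)]
  calc t j * e k i ≤ t j * (e k j * e j i) := mul_le_mul_of_nonneg_left (hm k j i) (ht j)
    _ = (t j * e k j) * e j i := by ring
    _ ≤ t k * e j i := mul_le_mul_of_nonneg_right a (hp _ _).le

theorem Mx.dom {n : ℕ} {e : Fin n → Fin n → ℝ} (hE : IsStandard e) {t : Fin n → ℝ}
    (ht : ∀ j, 0 ≤ t j) {i j : Fin n} (h : Mx e t i j) (k : Fin n) : t k ≤ e k j * t j := by
  obtain ⟨⟨hp, h1, hm⟩, -⟩ := hE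
  have a := h k
  rw [div_le_div_iff₀ (hp _ _) (hp _ _)] at a
  have b := mul_le_mul_of_nonneg_left (hm k j i) (ht j)
  have c : t k * e j i ≤ (e k j * t j) * e j i := by nlinarith
  exact le_of_mul_le_mul_right c (hp _ _)

theorem Mx_of_dom {n : ℕ} {e : Fin n → Fin n → ℝ} (hE : IsStandard e) {t : Fin n → ℝ}
    {j : Fin n} (h : ∀ k, t k ≤ e k j * t j) : Mx e t j j := by
  intro k
  rw [hE.1.2.1, div_one, div_le_iff₀ (hE.1.1 _ _)]
  linarith [h k]

theorem Mx.pos {n : ℕ} {e : Fin n → Fin n → ℝ} (hE : IsStandard e) {t : Fin n → ℝ}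
    (ht : ∀ j, 0 ≤ t j) (h0 : t ≠ 0) {i j : Fin n} (h : Mx e t i j) : 0 < t j := by
  rcases (ht j).lt_or_eq with h1 | h1
  · exact h1
  · exfalso
    apply h0
    funext k
    have := h.dom hE ht k
    rw [← h1, mul_zero] at this
    exact le_antisymm this (ht k)

theorem Mx_Dl_eq {n : ℕ} {e : Fin n → Fin n → ℝ} (hE : IsStandard e) {t : Fin n → ℝ}
    {d k : Fin n} (hd : d ∈ Dl e t) (h : Mx e t d k) : k = d := by
  by_contra hk
  have a := (mem_Dl.1 hd).2 k hk
  have b := h d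
  rw [hE.1.2.1, div_one, le_div_iff₀ (hE.1.1 _ _)] at b
  linarith

theorem Dl_self {n : ℕ} {e : Fin n → Fin n → ℝ} (hE : IsStandard e) {t : Fin n → ℝ}
    {d : Fin n} (hd : d ∈ Dl e t) : Mx e t d d := by
  apply Mx_of_dom hE
  intro k
  by_cases hk : k = d
  · subst hk; rw [hE.1.2.1, one_mul]
  · exact ((mem_Dl.1 hd).2 k hk).le

open Classical in
theorem exists_Dl {n : ℕ} {e : Fin n → Fin n → ℝ} (hE : IsStandard e) {t : Fin n → ℝ}
    (ht : ∀ j, 0 ≤ t j) (h0 : t ≠ 0) (i : Fin n) : ∃ d ∈ Dl e t, Mx e t i d := by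
  obtain ⟨j0, hj0⟩ := exists_Mx e t i
  obtain ⟨j, hj, hmin⟩ := Finset.exists_min_image
    (Finset.univ.filter (fun j => Mx e t i j))
    (fun j => (Finset.univ.filter (fun k => Mx e t j k)).card) ⟨j0, by simpa using hj0⟩
  simp only [Finset.mem_filter, Finset.mem_univ, true_and] at hj hmin
  refine ⟨j, mem_Dl.2 ⟨hj.pos hE ht h0, fun k hk => ?_⟩, hj⟩
  refine lt_of_le_of_ne (hj.dom hE ht k) fun heq => ?_
  have hjj : Mx e t j j := Mx_of_dom hE (hj.dom hE ht)
  have hjk : Mx e t j k := by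
    intro l
    have := hjj l
    rw [hE.1.2.1, div_one] at this
    rw [heq, mul_div_cancel_left₀ _ (hE.1.1 _ _).ne']
    exact this
  have hik := hj.trans hE ht hjk
  refine absurd (hmin k hik) (not_le.2 (Finset.card_lt_card ?_))
  rw [Finset.ssubset_iff_of_subset]
  · refine ⟨j, by simpa using hjj, ?_⟩
    simp only [Finset.mem_filter, Finset.mem_univ, true_and]
    intro hkj
    have a := hkj k
    rw [hE.1.2.1, div_one, le_div_iff₀ (hE.1.1 _ _), heq] at a
    have b := hE.2 j k (Ne.symm hk)
    have c := hj.pos hE ht h0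
    nlinarith
  · intro l hl
    simp only [Finset.mem_filter, Finset.mem_univ, true_and] at hl ⊢
    exact hjk.trans hE ht hl

theorem GammaS_Mx {n : ℕ} {e : Fin n → Fin n → ℝ} {t : Fin n → ℝ} {S : MarkedPartition n}
    (h : t ∈ GammaS e S) (i : Fin n) : ∃ d ∈ DS S, Mx e t i d := by
  obtain ⟨r, hr⟩ := S.cover i
  exact ⟨S.k r, Finset.mem_image_of_mem _ (Finset.mem_univ r), h.2 r i hr⟩

theorem exists_partition {n : ℕ} (e : Fin n → Fin n → ℝ) (σ : Fin n → Fin n)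
    (hσ : ∀ i, σ (σ i) = σ i) : ∃ S : MarkedPartition n, DS S = Finset.univ.image σ ∧
      ∀ t, t ∈ GammaS e S ↔ (∀ j, 0 ≤ t j) ∧ ∀ i, Mx e t i (σ i) := by
  let I := Finset.univ.image σ
  let f := I.equivFin
  let S : MarkedPartition n :=
    { s := I.card
      A := fun r => Finset.univ.filter (fun i => σ i = (f.symm r : Fin n))
      k := fun r => (f.symm r : Fin n)
      mem_k := by
        intro r
        have := (f.symm r).2
        obtain ⟨a, -, ha⟩ := Finset.mem_image.1 this
        simp only [Finset.mem_filter, Finset.mem_univ, true_and]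
        rw [← ha, hσ]
      disj := by
        intro r r' hr
        rw [Finset.disjoint_left]
        intro a ha ha'
        simp only [Finset.mem_filter, Finset.mem_univ, true_and] at ha ha'
        exact hr (f.symm.injective (Subtype.ext (ha.symm.trans ha')))
      cover := by
        intro i
        refine ⟨f ⟨σ i, Finset.mem_image_of_mem _ (Finset.mem_univ i)⟩, ?_⟩
        simp }
  refine ⟨S, ?_, ?_⟩
  · ext x
    simp only [DS, Finset.mem_image, Finset.mem_univ, true_and]
    constructor
    · rintro ⟨r, rfl⟩
      have := (f.symm r).2
      obtain ⟨a, -, ha⟩ := Finset.mem_image.1 this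
      exact ⟨a, ha⟩
    · rintro ⟨a, rfl⟩
      refine ⟨f ⟨σ a, Finset.mem_image_of_mem _ (Finset.mem_univ a)⟩, ?_⟩
      simp [S]
  · intro t
    constructor
    · rintro ⟨h0, h⟩
      refine ⟨h0, fun i => ?_⟩
      have := h (f ⟨σ i, Finset.mem_image_of_mem _ (Finset.mem_univ i)⟩) i (by simp [S])
      simpa [S, Mx] using this
    · rintro ⟨h0, h⟩
      refine ⟨h0, fun r i hi => ?_⟩
      have hi' : σ i = (f.symm r : Fin n) := by simpa [S] using hi
      have := h i
      rw [hi'] at this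
      exact this

/-- Weights separating everything. -/
theorem exists_weight {n : ℕ} {e : Fin n → Fin n → ℝ} (hp : ∀ i j, 0 < e i j)
    (rk : Fin n → ℕ) : ∃ w : Fin n → ℝ, (∀ j, 0 < w j) ∧
      ∀ i j k, rk j < rk k → w j / e j i < w k / e k i := by
  obtain ⟨C, hC1, hC⟩ : ∃ C : ℝ, 1 ≤ C ∧ ∀ i j k, e k i / e j i < C := by
    refine ⟨1 + ∑ p : Fin n × Fin n × Fin n, e p.2.2 p.1 / e p.2.1 p.1, ?_, ?_⟩
    · have : 0 ≤ ∑ p : Fin n × Fin n × Fin n, e p.2.2 p.1 / e p.2.1 p.1 :=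
        Finset.sum_nonneg fun p _ => (div_pos (hp _ _) (hp _ _)).le
      linarith
    · intro i j k
      have := Finset.single_le_sum
        (f := fun p : Fin n × Fin n × Fin n => e p.2.2 p.1 / e p.2.1 p.1)
        (fun p _ => (div_pos (hp _ _) (hp _ _)).le) (Finset.mem_univ (i, j, k))
      simp only at this
      linarith
  have hC0 : 0 < C := by linarith
  refine ⟨fun j => C ^ rk j, fun j => pow_pos hC0 _, fun i j k h => ?_⟩
  rw [div_lt_div_iff₀ (hp _ _) (hp _ _)]
  have h1 := hC i j k
  rw [div_lt_iff₀ (hp _ _)] at h1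
  have h2 : C ^ (rk j + 1) ≤ C ^ rk k := pow_le_pow_right₀ hC1 h
  calc C ^ rk j * e k i < C ^ rk j * (C * e j i) :=
        mul_lt_mul_of_pos_left h1 (pow_pos hC0 _)
    _ = C ^ (rk j + 1) * e j i := by ring
    _ ≤ C ^ rk k * e j i := mul_le_mul_of_nonneg_right h2 (hp _ _).le

theorem interior_nonempty {n : ℕ} {e : Fin n → Fin n → ℝ} {S : MarkedPartition n}
    {σ : Fin n → Fin n}
    (hS : ∀ t, t ∈ GammaS e S ↔ (∀ j, 0 ≤ t j) ∧ ∀ i, Mx e t i (σ i))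
    (u : Fin n → ℝ) (hu0 : ∀ j, 0 < u j)
    (hu : ∀ i j, j ≠ σ i → u j / e j i < u (σ i) / e (σ i) i) : S ∈ SE e := by
  refine ⟨u, mem_interior.2
    ⟨{t | (∀ j, 0 < t j) ∧ ∀ i j, j ≠ σ i → t j / e j i < t (σ i) / e (σ i) i}, ?_, ?_,
      ⟨hu0, hu⟩⟩⟩
  · rintro t ⟨h0, h⟩
    refine (hS t).2 ⟨fun j => (h0 j).le, fun i j => ?_⟩
    by_cases hj : j = σ i
    · rw [hj]
    · exact (h i j hj).le
  · simp only [Set.ofPred_and, Set.ofPred_forall]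
    refine IsOpen.inter (isOpen_iInter_of_finite fun j => ?_)
      (isOpen_iInter_of_finite fun i => isOpen_iInter_of_finite fun j =>
        isOpen_iInter_of_finite fun _ => ?_)
    · exact isOpen_lt continuous_const (continuous_apply j)
    · exact isOpen_lt ((continuous_apply j).div_const _) ((continuous_apply _).div_const _)

open Classical in
theorem exists_special {n : ℕ} {e : Fin n → Fin n → ℝ} (hE : IsStandard e) {t : Fin n → ℝ}
    (ht : ∀ j, 0 ≤ t j) (h0 : t ≠ 0) :
    ∃ S : MarkedPartition n, S ∈ SE e ∧ t ∈ GammaS e S ∧ DS S = Dl e t := by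
  let rk : Fin n → ℕ := fun j => if j ∈ Dl e t then n + j else j
  have hrk : Function.Injective rk := by
    intro a b hab
    simp only [rk] at hab
    apply Fin.ext
    have := a.2
    have := b.2
    split_ifs at hab <;> omega
  have hex : ∀ i, ∃ d, Mx e t i d ∧ ∀ j, Mx e t i j → rk j ≤ rk d := by
    intro i
    obtain ⟨j0, hj0⟩ := exists_Mx e t i
    obtain ⟨d, hd, hmax⟩ := Finset.exists_max_image
      (Finset.univ.filter (fun j => Mx e t i j)) rk ⟨j0, by simpa using hj0⟩
    exact ⟨d, by simpa using hd, fun j hj => hmax j (by simpa using hj)⟩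
  choose σ hσM hσmax using hex
  have hσD : ∀ i, σ i ∈ Dl e t := by
    intro i
    obtain ⟨d, hd, hM⟩ := exists_Dl hE ht h0 i
    have := hσmax i d hM
    by_contra hn
    simp only [rk, hd, hn, if_true, if_false] at this
    have := (σ i).2
    omega
  have hid : ∀ d ∈ Dl e t, σ d = d := fun d hd => Mx_Dl_eq hE hd (hσM d)
  obtain ⟨S, hDS, hS⟩ := exists_partition e σ (fun i => hid _ (hσD i))
  obtain ⟨w, hw0, hw⟩ := exists_weight hE.1.1 rk
  refine ⟨S, ?_, (hS t).2 ⟨ht, hσM⟩, ?_⟩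
  · have key : ∀ᶠ ε : ℝ in nhdsWithin 0 (Set.Ioi 0), ∀ i j, j ≠ σ i →
        (t j + ε * w j) / e j i < (t (σ i) + ε * w (σ i)) / e (σ i) i := by
      rw [Filter.eventually_all]; intro i
      rw [Filter.eventually_all]; intro j
      rw [Filter.eventually_all]; intro hj
      by_cases hM : Mx e t i j
      · filter_upwards [self_mem_nhdsWithin] with ε hε
        have h1 := hσM i j
        have hlt : rk j < rk (σ i) := lt_of_le_of_ne (hσmax i j hM) (fun h => hj (hrk h))
        have h2 := mul_lt_mul_of_pos_left (hw i j (σ i) hlt) (Set.mem_Ioi.1 hε)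
        rw [add_div, add_div, mul_div_assoc, mul_div_assoc]
        linarith
      · have hlt : t j / e j i < t (σ i) / e (σ i) i := by
          refine lt_of_le_of_ne (hσM i j) fun h => hM fun k => ?_
          rw [h]; exact hσM i k
        have hc : ∀ a : Fin n, Continuous fun ε : ℝ => (t a + ε * w a) / e a i := fun a => by
          fun_prop
        have := (isOpen_lt (hc j) (hc (σ i))).mem_nhds (x := (0 : ℝ)) (by simpa using hlt)
        exact nhdsWithin_le_nhds this
    obtain ⟨ε, hε, hε0⟩ := (key.and self_mem_nhdsWithin).exists
    refine interior_nonempty hS (fun j => t j + ε * w j) (fun j => ?_) hε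
    have := mul_pos (Set.mem_Ioi.1 hε0) (hw0 j)
    linarith [ht j]
  · rw [hDS]
    ext x
    simp only [Finset.mem_image, Finset.mem_univ, true_and]
    exact ⟨fun ⟨a, ha⟩ => ha ▸ hσD a, fun hx => ⟨x, hid x hx⟩⟩

theorem Dl_nonempty {n : ℕ} {e : Fin n → Fin n → ℝ} (hE : IsStandard e) {t : Fin n → ℝ}
    (ht : ∀ j, 0 ≤ t j) (h0 : t ≠ 0) : Dl e t ≠ ∅ := by
  obtain ⟨i, -⟩ := Function.ne_iff.1 h0
  obtain ⟨d, hd, -⟩ := exists_Dl hE ht h0 i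
  exact Finset.ne_empty_of_mem hd

theorem mem_GammaD {n : ℕ} {e : Fin n → Fin n → ℝ} (hE : IsStandard e) {t : Fin n → ℝ}
    (ht : ∀ j, 0 ≤ t j) (D : Finset (Fin n)) : t ∈ GammaD e D ↔ D = Dl e t := by
  have hz : Dl e (0 : Fin n → ℝ) = ∅ := by
    ext j; simp [mem_Dl]
  unfold GammaD
  split_ifs with hD
  · subst hD
    rw [Set.mem_singleton_iff]
    constructor
    · rintro rfl; exact hz.symm
    · intro h
      by_contra h0
      exact Dl_nonempty hE ht h0 h.symm
  · constructor
    · rintro ⟨h0, -, ⟨S, hS, htS, rfl⟩, hmin⟩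
      obtain ⟨T, hT, htT, hTD⟩ := exists_special hE ht h0
      refine Finset.Subset.antisymm (hTD ▸ hmin T hT htT) fun d hd => ?_
      obtain ⟨k, hk, hM⟩ := GammaS_Mx htS d
      rwa [Mx_Dl_eq hE hd hM] at hk
    · rintro rfl
      have h0 : t ≠ 0 := by rintro rfl; exact hD hz
      refine ⟨h0, ht, exists_special hE ht h0, fun T _ htT d hd => ?_⟩
      obtain ⟨k, hk, hM⟩ := GammaS_Mx htT d
      rwa [Mx_Dl_eq hE hd hM] at hk

theorem Nm_mem {n : ℕ} {e : Fin n → Fin n → ℝ} (hE : IsStandard e) {t : Fin n → ℝ}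
    (ht : ∀ j, 0 ≤ t j) : Nm e t ∈ GammaE e := by
  refine ⟨fun j => (ht j).trans (self_le_Nm hE t j), fun i k => ?_⟩
  obtain ⟨⟨hp, h1, hm⟩, -⟩ := hE
  apply Nm_le
  intro d
  refine le_trans ?_ (mul_le_mul_of_nonneg_left (le_Nm e t k d) (hp _ _).le)
  rw [← mul_div_assoc, div_le_div_iff₀ (hp _ _) (hp _ _)]
  nlinarith [mul_le_mul_of_nonneg_left (hm d i k) (ht d)]

theorem Mx.Nm_self {n : ℕ} {e : Fin n → Fin n → ℝ} (hE : IsStandard e) {t : Fin n → ℝ}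
    (ht : ∀ j, 0 ≤ t j) {i d : Fin n} (h : Mx e t i d) : Nm e t d = t d := by
  rw [(Mx_of_dom hE (h.dom hE ht)).Nm_eq, hE.1.2.1, div_one]

theorem Nm_mem_S {n : ℕ} {e : Fin n → Fin n → ℝ} (hE : IsStandard e) {t : Fin n → ℝ}
    {S : MarkedPartition n} (h : t ∈ GammaS e S) : Nm e t ∈ GammaS e S ∩ GammaE e := by
  have hN := Nm_mem hE h.1
  refine ⟨⟨hN.1, fun r i hi j => ?_⟩, hN⟩
  have hM : Mx e t i (S.k r) := h.2 r i hi
  rw [hM.Nm_self hE h.1, ← hM.Nm_eq, div_le_iff₀ (hE.1.1 _ _), mul_comm]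
  exact hN.2 j i

theorem castNonneg {n : ℕ} (L : Fin n → ℕ) (j : Fin n) : 0 ≤ (fun j => (L j : ℝ)) j :=
  Nat.cast_nonneg _

theorem Nm_le_add_one {n : ℕ} {e : Fin n → Fin n → ℝ} (hE : IsStandard e)
    {D : Finset (Fin n)} {L : Fin n → ℕ} (hL : L ∈ LLD e D) (j : Fin n) :
    Nm e (fun j => (L j : ℝ)) j ≤ L j + 1 := by
  obtain ⟨hG, hmax⟩ := hL
  rw [mem_GammaD hE (castNonneg L)] at hG
  by_cases hj : j ∈ D
  · rw [hG] at hj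
    rw [(Dl_self hE hj).Nm_self hE (castNonneg L)]
    simp
  · by_contra! hlt
    refine hmax j hj ?_
    rw [mem_GammaD hE (castNonneg _)]
    have hupd : ∀ k, k ≠ j → (Function.update L j (L j + 1)) k = L k := fun k hk =>
      Function.update_of_ne hk _ _
    have hupj : (Function.update L j (L j + 1)) j = L j + 1 := Function.update_self _ _ _
    have hmono : ∀ k, (L k : ℝ) ≤ (Function.update L j (L j + 1)) k := by
      intro k
      by_cases hk : k = j
      · subst hk; rw [hupj]; push_cast; linarith
      · rw [hupd k hk]
    apply Finset.Subset.antisymm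
    · intro d hd
      have hdj : d ≠ j := fun h => hj (h ▸ hd)
      rw [hG] at hd
      have hd' := mem_Dl.1 hd
      refine mem_Dl.2 ⟨?_, fun k hk => ?_⟩
      · simpa only [hupd d hdj] using hd'.1
      · simp only [hupd d hdj]
        by_cases hkj : k = j
        · subst hkj
          rw [hupj]
          have h1 := (Nm_mem hE (castNonneg L)).2 k d
          rw [(Dl_self hE hd).Nm_self hE (castNonneg L)] at h1
          push_cast
          exact hlt.trans_le h1
        · rw [hupd k hkj]; exact hd'.2 k hk
    · intro d hd
      have hd' := mem_Dl.1 hd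
      by_cases hdj : d = j
      · exfalso
        subst hdj
        obtain ⟨k, hk⟩ := Nm_attained e (fun j => (L j : ℝ)) d
        by_cases hkd : k = d
        · subst hkd
          rw [hE.1.2.1, div_one] at hk
          linarith
        · have := hd'.2 k hkd
          rw [hupj, hupd k hkd] at this
          rw [← hk, lt_div_iff₀ (hE.1.1 _ _)] at hlt
          push_cast at this
          linarith
      · rw [hG]
        rw [hupd d hdj] at hd'
        exact mem_Dl.2 ⟨hd'.1, fun k hk => (hmono k).trans_lt (hd'.2 k hk)⟩

theorem Nm_mono {n : ℕ} {e : Fin n → Fin n → ℝ} (hE : IsStandard e) {t u : Fin n → ℝ}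
    (h : ∀ j, t j ≤ u j) (i : Fin n) : Nm e t i ≤ Nm e u i :=
  Nm_le fun j => (div_le_div_of_nonneg_right (h j) (hE.1.1 _ _).le).trans (le_Nm e u i j)

theorem Nm_nonneg {n : ℕ} {e : Fin n → Fin n → ℝ} (hE : IsStandard e) {t : Fin n → ℝ}
    (ht : ∀ j, 0 ≤ t j) (i : Fin n) : 0 ≤ Nm e t i := (Nm_mem hE ht).1 i

/-- If `u` agrees with `t` on the dominant set of `u` then `u ≤ Nm t`. -/
theorem le_Nm_of_agree {n : ℕ} {e : Fin n → Fin n → ℝ} (hE : IsStandard e) {t u : Fin n → ℝ}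
    (ht : ∀ j, 0 ≤ t j) (hu : ∀ j, 0 ≤ u j) (h : ∀ d ∈ Dl e u, u d = t d) (i : Fin n) :
    u i ≤ Nm e t i := by
  by_cases h0 : u = 0
  · rw [h0]; exact Nm_nonneg hE ht i
  · obtain ⟨d, hd, hM⟩ := exists_Dl hE hu h0 i
    refine (self_le_Nm hE u i).trans ?_
    rw [hM.Nm_eq, h d hd]
    exact le_Nm e t i d

theorem exists_LL {n : ℕ} {e : Fin n → Fin n → ℝ} (hE : IsStandard e) (P : Fin n → ℕ) :
    ∃ M ∈ LLall e, (∀ i, P i ≤ M i) ∧ ∀ i, (M i : ℝ) ≤ Nm e (fun j => (P j : ℝ)) i := by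
  let X : Set (Fin n → ℕ) := {Q | P ≤ Q ∧
    Dl e (fun j => (Q j : ℝ)) = Dl e (fun j => (P j : ℝ)) ∧
    ∀ d ∈ Dl e (fun j => (P j : ℝ)), Q d = P d}
  have hX : ∀ Q ∈ X, ∀ i, (Q i : ℝ) ≤ Nm e (fun j => (P j : ℝ)) i := by
    rintro Q ⟨-, h1, h2⟩ i
    refine le_Nm_of_agree hE (u := fun j => (Q j : ℝ)) (castNonneg P) (castNonneg Q) ?_ i
    intro d hd
    rw [h1] at hd
    simp only [h2 d hd]
  have hfin : X.Finite := by
    refine (Set.finite_Iic (fun i => ⌊Nm e (fun j => (P j : ℝ)) i⌋₊)).subset ?_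
    intro Q hQ i
    exact Nat.le_floor (hX Q hQ i)
  obtain ⟨Q, hQ⟩ := hfin.exists_maximal ⟨P, le_refl P, rfl, fun _ _ => rfl⟩
  have hQX := hQ.prop
  refine ⟨Q, Set.mem_iUnion.2 ⟨Dl e (fun j => (P j : ℝ)), ?_, ?_⟩, hQX.1, hX Q hQX⟩
  · rw [mem_GammaD hE (castNonneg Q)]; exact hQX.2.1.symm
  · intro j hj hG
    rw [mem_GammaD hE (castNonneg _)] at hG
    have hle : Q ≤ Function.update Q j (Q j + 1) := by
      intro k
      by_cases hk : k = j
      · subst hk; simp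
      · rw [Function.update_of_ne hk]
    have := hQ.le_of_ge (y := Function.update Q j (Q j + 1))
      ⟨hQX.1.trans hle, hG.symm, fun d hd => ?_⟩ hle j
    · simp at this
    · rw [Function.update_of_ne (show d ≠ j from fun h => hj (h ▸ hd))]
      exact hQX.2.2 d hd

theorem tube_bound {n : ℕ} {e : Fin n → Fin n → ℝ} (hE : IsStandard e)
    {D D' : Finset (Fin n)} {L L' : Fin n → ℕ}
    (hL : L ∈ LLD e D) (hL' : L' ∈ LLD e D') {t : Fin n → ℝ} (h1 : t ∈ Tube D L)
    (h2 : t ∈ Tube D' L') (i : Fin n) :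
    (L i : ℝ) - L' i ≤ 2 + ∑ p : Fin n × Fin n, 1 / e p.1 p.2 := by
  have hs : ∀ a b, 1 / e a b ≤ ∑ p : Fin n × Fin n, 1 / e p.1 p.2 := fun a b =>
    Finset.single_le_sum (f := fun p : Fin n × Fin n => 1 / e p.1 p.2)
      (fun p _ => (div_pos one_pos (hE.1.1 _ _)).le) (Finset.mem_univ (a, b))
  have hs0 := (div_pos one_pos (hE.1.1 i i)).le.trans (hs i i)
  by_cases h0 : (fun j => (L j : ℝ)) = 0
  · have := congrFun h0 i
    simp only [Pi.zero_apply] at this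
    have h3 : (0 : ℝ) ≤ L' i := Nat.cast_nonneg _
    linarith
  · obtain ⟨d, hd, hM⟩ := exists_Dl hE (castNonneg L) h0 i
    have hG := hL.1
    rw [mem_GammaD hE (castNonneg L)] at hG
    rw [← hG] at hd
    have a := (h1 d).2.2 hd
    have b := (h2 d).2.1
    have c : (L i : ℝ) ≤ L d / e d i := hM.Nm_eq ▸ self_le_Nm hE (fun j => (L j : ℝ)) i
    have c2 : (L d : ℝ) / e d i ≤ (L' d + 1) / e d i :=
      div_le_div_of_nonneg_right (by linarith) (hE.1.1 _ _).le
    rw [add_div] at c2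
    have c3 := le_Nm e (fun j => (L' j : ℝ)) i d
    have c4 := Nm_le_add_one hE hL' i
    have c5 := hs d i
    linarith

/-- distances between `𝓛`, the faces `F_S = Γ_S ∩ Γ(E)`, the principal
cone `Γ(E)`, componentwise minima, and overlapping tubes, are all controlled by a
single constant `κ` depending only on `E`.  Here `dist` is the sup-distance on
`Fin n → ℝ`. -/
theorem stmt6 {n : ℕ} (e : Fin n → Fin n → ℝ) (hE : IsStandard e) :
    ∃ κ : ℝ, 0 < κ ∧
      (∀ L ∈ LLall e, ∀ S : MarkedPartition n, (fun j => (L j : ℝ)) ∈ GammaS e S →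
        ∃ u ∈ GammaS e S ∩ GammaE e, dist (fun j => (L j : ℝ)) u < κ) ∧
      (∀ L ∈ LLall e, ∃ u ∈ GammaE e, dist (fun j => (L j : ℝ)) u < κ) ∧
      (∀ t ∈ GammaE e, ∃ L ∈ LLall e, dist t (fun j => (L j : ℝ)) < κ) ∧
      (∀ L ∈ LLall e, ∀ L' ∈ LLall e, ∃ M ∈ LLall e,
        dist (fun j => ((min (L j) (L' j) : ℕ) : ℝ)) (fun j => (M j : ℝ)) < κ) ∧
      (∀ (D D' : Finset (Fin n)) (L L' : Fin n → ℕ),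
        L ∈ LLD e D → L' ∈ LLD e D' → (Tube D L ∩ Tube D' L').Nonempty →
        dist (fun j => (L j : ℝ)) (fun j => (L' j : ℝ)) ≤ κ) := by
  have hs0 : 0 ≤ ∑ p : Fin n × Fin n, 1 / e p.1 p.2 :=
    Finset.sum_nonneg fun p _ => (div_pos one_pos (hE.1.1 _ _)).le
  have hclose : ∀ κ : ℝ, 1 < κ → ∀ t u : Fin n → ℝ, (∀ i, t i ≤ u i) →
      (∀ i, u i ≤ t i + 1) → dist t u < κ := by
    intro κ hκ t u h1 h2
    refine lt_of_le_of_lt ((dist_pi_le_iff zero_le_one).2 fun i => ?_) hκ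
    rw [Real.dist_eq, abs_le]
    constructor <;> linarith [h1 i, h2 i]
  refine ⟨2 + ∑ p : Fin n × Fin n, 1 / e p.1 p.2, by linarith, ?_, ?_, ?_, ?_, ?_⟩
  · intro L hL S hS
    obtain ⟨D, hD⟩ := Set.mem_iUnion.1 hL
    exact ⟨_, Nm_mem_S hE hS, hclose _ (by linarith) _ _ (self_le_Nm hE _)
      (Nm_le_add_one hE hD)⟩
  · intro L hL
    obtain ⟨D, hD⟩ := Set.mem_iUnion.1 hL
    exact ⟨_, Nm_mem hE (castNonneg L), hclose _ (by linarith) _ _ (self_le_Nm hE _)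
      (Nm_le_add_one hE hD)⟩
  · intro t ht
    obtain ⟨M, hM, hPM, hMN⟩ := exists_LL hE (fun i => ⌊t i⌋₊)
    refine ⟨M, hM, ?_⟩
    rw [dist_comm]
    refine hclose _ (by linarith) _ _ (fun i => ?_) (fun i => ?_)
    · refine (hMN i).trans (Nm_le fun j => ?_)
      rw [div_le_iff₀ (hE.1.1 _ _), mul_comm]
      exact (Nat.floor_le (ht.1 j)).trans (ht.2 j i)
    · have h1 : ((⌊t i⌋₊ : ℕ) : ℝ) ≤ M i := by exact_mod_cast hPM i
      linarith [Nat.lt_floor_add_one (t i)]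
  · intro L hL L' hL'
    obtain ⟨D, hD⟩ := Set.mem_iUnion.1 hL
    obtain ⟨D', hD'⟩ := Set.mem_iUnion.1 hL'
    obtain ⟨M, hM, hPM, hMN⟩ := exists_LL hE (fun i => min (L i) (L' i))
    refine ⟨M, hM, hclose _ (by linarith) _ _ (fun i => by exact_mod_cast hPM i) (fun i => ?_)⟩
    have h1 := (Nm_mono hE (t := fun j => ((min (L j) (L' j) : ℕ) : ℝ))
      (u := fun j => (L j : ℝ)) (fun j => by exact_mod_cast min_le_left _ _) i).trans
      (Nm_le_add_one hE hD i)
    have h2 := (Nm_mono hE (t := fun j => ((min (L j) (L' j) : ℕ) : ℝ))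
      (u := fun j => (L' j : ℝ)) (fun j => by exact_mod_cast min_le_right _ _) i).trans
      (Nm_le_add_one hE hD' i)
    have h3 := hMN i
    rcases min_choice (L i) (L' i) with h | h
    · simp only [h]; exact h3.trans h1
    · simp only [h]; exact h3.trans h2
  · rintro D D' L L' hL hL' ⟨t, h1, h2⟩
    refine (dist_pi_le_iff (by linarith)).2 fun i => ?_
    rw [Real.dist_eq, abs_le]
    constructor
    · linarith [tube_bound hE hL' hL h2 h1 i]
    · exact tube_bound hE hL hL' h1 h2 i
end
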